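/- For every integer n ≥ 4 there exists x_n* ∈ (54/100, 1) such that h₁(x_n*) = 0 and h₀(x_n*) > 0. -/

import Mathlib

/-- `k_n = (1/(4n)) · Σ_{k=1}^{n-1} 1/sin(kπ/n)` -/
noncomputable def kn (n : ℕ) : ℝ :=
  (1 / (4 * n)) * ∑ k ∈ Finset.Icc 1 (n - 1), 1 / Real.sin (k * Real.pi / n)

/-- `φ_k = (2k-1)π/n`, and `u_k = cos φ_k`. -/
noncomputable def phi (n k : ℕ) : ℝ := (2 * (k : ℝ) - 1) * Real.pi / n

/-- `h₀(x) = −n·k_n + (x²(1−x²)/(1−x³))·Σ_{k=1}^{n} u_k/(1+x²−2xu_k)^{3/2}` -/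
noncomputable def h0 (n : ℕ) (x : ℝ) : ℝ :=
  -((n : ℝ) * kn n) + (x ^ 2 * (1 - x ^ 2) / (1 - x ^ 3)) * ∑ k ∈ Finset.Icc 1 n,
    Real.cos (phi n k) / (1 + x ^ 2 - 2 * x * Real.cos (phi n k)) ^ ((3 : ℝ) / 2)

/-- `h₁(x) = n·k_n/(1−x³) − (x³/(1−x³))·Σ_{k=1}^{n} (1−xu_k)/(1+x²−2xu_k)^{3/2}` -/
noncomputable def h1 (n : ℕ) (x : ℝ) : ℝ :=
  (n : ℝ) * kn n / (1 - x ^ 3) - (x ^ 3 / (1 - x ^ 3)) * ∑ k ∈ Finset.Icc 1 n,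
    (1 - x * Real.cos (phi n k)) / (1 + x ^ 2 - 2 * x * Real.cos (phi n k)) ^ ((3 : ℝ) / 2)

/-- Squared distance between `x` and `exp (i φ_k)`. -/
noncomputable def sqDist (n : ℕ) (x : ℝ) (k : ℕ) : ℝ := 1 + x ^ 2 - 2 * x * Real.cos (phi n k)

/-- Reciprocal distance between `x` and `exp (i φ_k)`. -/
noncomputable def invDist (n : ℕ) (x : ℝ) (k : ℕ) : ℝ := (Real.sqrt (sqDist n x k))⁻¹

lemma half_phi_mem {n k : ℕ} (hk : k ∈ Finset.Icc 1 n) :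
    phi n k / 2 ∈ Set.Ioo 0 Real.pi := by
  rw [Finset.mem_Icc] at hk
  have h1 : (1 : ℝ) ≤ k := by exact_mod_cast hk.1
  have h2 : (k : ℝ) ≤ n := by exact_mod_cast hk.2
  have hn : (0 : ℝ) < n := by linarith
  have hpi := Real.pi_pos
  unfold phi
  refine ⟨by have : (0 : ℝ) < 2 * k - 1 := by linarith
             positivity, ?_⟩
  rw [div_div, div_lt_iff₀ (by positivity)]
  nlinarith

lemma one_sub_cos_phi (n k : ℕ) : 1 - Real.cos (phi n k) = 2 * Real.sin (phi n k / 2) ^ 2 := by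
  have h := Real.cos_two_mul (phi n k / 2)
  have h' := Real.sin_sq_add_cos_sq (phi n k / 2)
  rw [show 2 * (phi n k / 2) = phi n k by ring] at h
  linarith

lemma sqDist_pos {n k : ℕ} {x : ℝ} (hx : 0 < x) (hk : k ∈ Finset.Icc 1 n) :
    0 < sqDist n x k := by
  have h1 := one_sub_cos_phi n k
  have h2 := Real.sin_pos_of_mem_Ioo (half_phi_mem hk)
  have h3 : 0 < x * Real.sin (phi n k / 2) ^ 2 := by positivity
  unfold sqDist
  nlinarith [sq_nonneg (1 - x)]

lemma invDist_pos {n k : ℕ} {x : ℝ} (hx : 0 < x) (hk : k ∈ Finset.Icc 1 n) :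
    0 < invDist n x k :=
  inv_pos.2 (Real.sqrt_pos.2 (sqDist_pos hx hk))

lemma invDist_sq {n k : ℕ} {x : ℝ} (hx : 0 < x) (hk : k ∈ Finset.Icc 1 n) :
    invDist n x k ^ 2 = (sqDist n x k)⁻¹ := by
  rw [invDist, inv_pow, Real.sq_sqrt (sqDist_pos hx hk).le]

lemma invDist_sq_mul {n k : ℕ} {x : ℝ} (hx : 0 < x) (hk : k ∈ Finset.Icc 1 n) :
    invDist n x k ^ 2 * (1 + x ^ 2 - 2 * x * Real.cos (phi n k)) = 1 := by
  rw [invDist_sq hx hk]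
  exact inv_mul_cancel₀ (sqDist_pos hx hk).ne'

lemma div_rpow_eq_mul_invDist {n k : ℕ} {x : ℝ} (hx : 0 < x) (hk : k ∈ Finset.Icc 1 n) (a : ℝ) :
    a / (1 + x ^ 2 - 2 * x * Real.cos (phi n k)) ^ ((3 : ℝ) / 2) = a * invDist n x k ^ 3 := by
  have h := sqDist_pos hx hk
  rw [invDist, inv_pow, div_eq_mul_inv, ← sqDist, Real.sqrt_eq_rpow, ← Real.rpow_natCast,
    ← Real.rpow_mul h.le]
  norm_num

lemma radial_term {n k : ℕ} {x : ℝ} (hx : 0 < x) (hk : k ∈ Finset.Icc 1 n) :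
    (1 - x * Real.cos (phi n k)) / (1 + x ^ 2 - 2 * x * Real.cos (phi n k)) ^ ((3 : ℝ) / 2) =
      ((1 - x ^ 2) * invDist n x k ^ 3 + invDist n x k) / 2 := by
  rw [div_rpow_eq_mul_invDist hx hk]
  linear_combination (1 / 2 * invDist n x k) * invDist_sq_mul hx hk

lemma cos_term {n k : ℕ} {x : ℝ} (hx : 0 < x) (hk : k ∈ Finset.Icc 1 n) :
    Real.cos (phi n k) / (1 + x ^ 2 - 2 * x * Real.cos (phi n k)) ^ ((3 : ℝ) / 2) =
      ((1 + x ^ 2) * invDist n x k ^ 3 - invDist n x k) / (2 * x) := by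
  rw [div_rpow_eq_mul_invDist hx hk]
  field_simp
  linear_combination (-1 * invDist n x k) * invDist_sq_mul hx hk

lemma sum_radial (n : ℕ) {x : ℝ} (hx : 0 < x) :
    ∑ k ∈ Finset.Icc 1 n, (1 - x * Real.cos (phi n k)) /
        (1 + x ^ 2 - 2 * x * Real.cos (phi n k)) ^ ((3 : ℝ) / 2) =
      ((1 - x ^ 2) * ∑ k ∈ Finset.Icc 1 n, invDist n x k ^ 3 +
        ∑ k ∈ Finset.Icc 1 n, invDist n x k) / 2 := by
  rw [Finset.sum_congr rfl fun k hk => radial_term hx hk, ← Finset.sum_div,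
    Finset.sum_add_distrib, Finset.mul_sum]

lemma sum_cos (n : ℕ) {x : ℝ} (hx : 0 < x) :
    ∑ k ∈ Finset.Icc 1 n, Real.cos (phi n k) /
        (1 + x ^ 2 - 2 * x * Real.cos (phi n k)) ^ ((3 : ℝ) / 2) =
      ((1 + x ^ 2) * ∑ k ∈ Finset.Icc 1 n, invDist n x k ^ 3 -
        ∑ k ∈ Finset.Icc 1 n, invDist n x k) / (2 * x) := by
  rw [Finset.sum_congr rfl fun k hk => cos_term hx hk, ← Finset.sum_div,
    Finset.sum_sub_distrib, Finset.mul_sum]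

/-- A nontrivial `n`-th root of unity has vanishing power sum over `1, …, n`. -/
lemma sum_Icc_pow_eq_zero {n : ℕ} {r : ℂ} (h : r ^ n = 1) (h1 : r ≠ 1) :
    ∑ k ∈ Finset.Icc 1 n, r ^ k = 0 := by
  have hg : ∑ k ∈ Finset.range n, r ^ k = 0 := by
    rw [geom_sum_eq h1, h, sub_self, zero_div]
  have : ∑ k ∈ Finset.Icc 1 n, r ^ k = ∑ k ∈ Finset.range n, r ^ (k + 1) := by
    rw [Finset.range_eq_Ico, Finset.sum_Ico_add' (fun k => r ^ k) 0 n 1]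
    rfl
  simp [this, pow_succ, ← Finset.sum_mul, hg]

lemma exp_phi (n k : ℕ) : Complex.exp (phi n k * Complex.I) =
    Complex.exp (-(Real.pi * Complex.I / n)) * Complex.exp (2 * Real.pi * Complex.I / n) ^ k := by
  rw [← Complex.exp_nat_mul, ← Complex.exp_add]
  congr 1
  simp only [phi]
  push_cast
  ring

lemma sum_exp_phi_pow {n j : ℕ} (hj : j ≠ 0) (hjn : j < n) :
    ∑ k ∈ Finset.Icc 1 n, Complex.exp (phi n k * Complex.I) ^ j = 0 := by
  have hp := Complex.isPrimitiveRoot_exp n (by omega)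
  have h1 := hp.pow_ne_one_of_pos_of_lt hj hjn
  have h2 : (Complex.exp (2 * Real.pi * Complex.I / n) ^ j) ^ n = 1 := by
    rw [← pow_mul, mul_comm j n, pow_mul, hp.pow_eq_one, one_pow]
  have := sum_Icc_pow_eq_zero h2 h1
  simp_rw [exp_phi, mul_pow, ← pow_mul, mul_comm _ j, pow_mul, ← Finset.mul_sum]
  rw [this, mul_zero]

lemma exp_phi_pow_self {n : ℕ} (hn : n ≠ 0) (k : ℕ) :
    Complex.exp (phi n k * Complex.I) ^ n = -1 := by
  have hp := Complex.isPrimitiveRoot_exp n hn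
  have hn' : (n : ℂ) ≠ 0 := by exact_mod_cast hn
  rw [exp_phi, mul_pow, ← pow_mul, mul_comm k n, pow_mul, hp.pow_eq_one, one_pow, mul_one,
    ← Complex.exp_nat_mul, show (n : ℂ) * -(Real.pi * Complex.I / n) = -(Real.pi * Complex.I) by
      field_simp, Complex.exp_neg, Complex.exp_pi_mul_I]
  norm_num

lemma sum_inv_one_sub {n : ℕ} (hn : n ≠ 0) {x : ℝ} (hx : 0 < x) :
    ∑ k ∈ Finset.Icc 1 n, (1 - x * Complex.exp (phi n k * Complex.I))⁻¹ =
      (n / (1 + x ^ n) : ℝ) := by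
  have hpos : (0 : ℝ) < 1 + x ^ n := by positivity
  have hne : (1 + (x : ℂ) ^ n) ≠ 0 := by exact_mod_cast hpos.ne'
  have key : ∀ k ∈ Finset.Icc 1 n, (1 - x * Complex.exp (phi n k * Complex.I))⁻¹ =
      (∑ j ∈ Finset.range n, (x : ℂ) ^ j * Complex.exp (phi n k * Complex.I) ^ j) /
        (1 + (x : ℂ) ^ n) := by
    intro k _
    have hg := mul_neg_geom_sum ((x : ℂ) * Complex.exp (phi n k * Complex.I)) n
    rw [mul_pow, exp_phi_pow_self hn, mul_neg_one, sub_neg_eq_add] at hg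
    simp_rw [mul_pow] at hg
    have h0 : 1 - x * Complex.exp (phi n k * Complex.I) ≠ 0 := by
      intro h
      rw [h, zero_mul] at hg
      exact hne hg.symm
    rw [eq_div_iff hne, ← hg, inv_mul_cancel_left₀ h0]
  rw [Finset.sum_congr rfl key, ← Finset.sum_div, Finset.sum_comm]
  simp_rw [← Finset.mul_sum]
  rw [Finset.sum_eq_single 0]
  · simp
  · intro j hj hj0
    rw [sum_exp_phi_pow hj0 (Finset.mem_range.1 hj), mul_zero]
  · intro h
    exact absurd (Finset.mem_range.2 (Nat.pos_of_ne_zero hn)) h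

/-- The Poisson kernel averaged over the `n`-th roots of `-1`. -/
lemma sum_invDist_sq {n : ℕ} (hn : n ≠ 0) {x : ℝ} (hx : 0 < x) :
    (1 - x ^ 2) * ∑ k ∈ Finset.Icc 1 n, invDist n x k ^ 2 = n * ((1 - x ^ n) / (1 + x ^ n)) := by
  have hpos : (0 : ℝ) < 1 + x ^ n := by positivity
  have key : ∀ k ∈ Finset.Icc 1 n, (1 - x ^ 2) * invDist n x k ^ 2 =
      2 * ((1 - x * Complex.exp (phi n k * Complex.I))⁻¹).re - 1 := by
    intro k hk
    have hd := sqDist_pos hx hk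
    have hre : (1 - x * Complex.exp (phi n k * Complex.I)).re = 1 - x * Real.cos (phi n k) := by
      simp [Complex.exp_ofReal_mul_I_re]
    have him : (1 - x * Complex.exp (phi n k * Complex.I)).im = -(x * Real.sin (phi n k)) := by
      simp [Complex.exp_ofReal_mul_I_im]
    have hns : Complex.normSq (1 - x * Complex.exp (phi n k * Complex.I)) = sqDist n x k := by
      rw [Complex.normSq_apply, hre, him, sqDist]
      linear_combination x ^ 2 * Real.sin_sq_add_cos_sq (phi n k)
    rw [Complex.inv_re, hns, hre, invDist_sq hx hk]
    field_simp
    unfold sqDist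
    ring
  rw [Finset.mul_sum, Finset.sum_congr rfl key, Finset.sum_sub_distrib, ← Finset.mul_sum,
    ← Complex.re_sum, sum_inv_one_sub hn hx, Complex.ofReal_re]
  simp
  field_simp
  ring

/-- A strict form of Chebyshev's sum inequality for `a` and `a ^ 2`. -/
lemma mul_sum_lt_sum_pow_three {ι : Type*} {s : Finset ι} {a : ι → ℝ} {Q : ℝ}
    (ha : ∀ i ∈ s, 0 < a i) (hQ : 0 ≤ Q) (hsum : ∑ i ∈ s, a i ^ 2 = s.card * Q)
    {i j : ι} (hi : i ∈ s) (hj : j ∈ s) (hij : a i ≠ a j) :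
    Q * ∑ i ∈ s, a i < ∑ i ∈ s, a i ^ 3 := by
  obtain ⟨q, hq, rfl⟩ : ∃ q : ℝ, 0 ≤ q ∧ q ^ 2 = Q := ⟨√Q, Real.sqrt_nonneg _, Real.sq_sqrt hQ⟩
  have hnn : ∀ i ∈ s, 0 ≤ (a i - q) ^ 2 * (a i + q) := fun i hi => by
    have := ha i hi
    positivity
  obtain ⟨l, hl, hlq⟩ : ∃ l ∈ s, a l ≠ q := by
    by_contra! h
    exact hij ((h i hi).trans (h j hj).symm)
  have hlpos : 0 < (a l - q) ^ 2 * (a l + q) := by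
    have := ha l hl
    have := sub_ne_zero.2 hlq
    positivity
  have hpos := Finset.sum_pos' hnn ⟨l, hl, hlpos⟩
  have hexp : ∑ i ∈ s, (a i - q) ^ 2 * (a i + q) =
      ∑ i ∈ s, a i ^ 3 - q ^ 2 * ∑ i ∈ s, a i - q * ∑ i ∈ s, a i ^ 2 + s.card * q ^ 3 := by
    rw [Finset.mul_sum, Finset.mul_sum, ← nsmul_eq_mul, ← Finset.sum_const,
      ← Finset.sum_sub_distrib, ← Finset.sum_sub_distrib, ← Finset.sum_add_distrib]
    exact Finset.sum_congr rfl fun i _ => by ring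
  rw [hexp, hsum] at hpos
  linarith

lemma invDist_one_ne_two {n : ℕ} (hn : 3 ≤ n) {x : ℝ} (hx : 0 < x) :
    invDist n x 1 ≠ invDist n x 2 := by
  have hnr : (3 : ℝ) ≤ n := by exact_mod_cast hn
  have hpi := Real.pi_pos
  have hlt : Real.cos (phi n 2) < Real.cos (phi n 1) := by
    apply Real.cos_lt_cos_of_nonneg_of_le_pi
    · unfold phi
      norm_num
      positivity
    · unfold phi
      rw [div_le_iff₀ (by linarith)]
      push_cast
      nlinarith
    · unfold phi
      push_cast
      gcongr
      norm_num
  intro h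
  have h1 := invDist_sq_mul (n := n) (k := 1) hx (Finset.mem_Icc.2 ⟨by omega, by omega⟩)
  have h2 := invDist_sq_mul (n := n) (k := 2) hx (Finset.mem_Icc.2 ⟨by omega, by omega⟩)
  have hp := invDist_pos (n := n) (k := 2) hx (Finset.mem_Icc.2 ⟨by omega, by omega⟩)
  rw [h] at h1
  have : 0 < invDist n x 2 ^ 2 * x * (Real.cos (phi n 1) - Real.cos (phi n 2)) := by
    have := sub_pos.2 hlt
    positivity
  nlinarith

lemma invDist_sum_lt_of_five_le {n : ℕ} (hn : 5 ≤ n) {x : ℝ} (hx : 0 < x) (hx1 : x < 1) :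
    (1 - x ^ 5) * ∑ k ∈ Finset.Icc 1 n, invDist n x k <
      (1 - x ^ 2) * (1 + x ^ 5) * ∑ k ∈ Finset.Icc 1 n, invDist n x k ^ 3 := by
  have hx2 : 0 < 1 - x ^ 2 := by nlinarith
  have hxn : x ^ n ≤ x ^ 5 := pow_le_pow_of_le_one hx.le hx1.le hn
  have hxn1 : x ^ n < 1 := pow_lt_one₀ hx.le hx1 (by omega)
  have hxnp : 0 < x ^ n := by positivity
  have hx5 : 0 < x ^ 5 := by positivity
  set Q := (1 - x ^ n) / (1 + x ^ n) / (1 - x ^ 2) with hQ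
  have hsum : ∑ k ∈ Finset.Icc 1 n, invDist n x k ^ 2 = (Finset.Icc 1 n).card * Q := by
    have := sum_invDist_sq (by omega : n ≠ 0) hx
    rw [Nat.card_Icc, Nat.add_sub_cancel, hQ, ← mul_div_assoc, eq_div_iff hx2.ne', ← this, mul_comm]
  have hQ0 : 0 ≤ Q := by
    have := sub_pos.2 hxn1
    positivity
  have hch := mul_sum_lt_sum_pow_three (fun k hk => invDist_pos (n := n) hx hk) hQ0 hsum
    (i := 1) (j := 2) (Finset.mem_Icc.2 ⟨by omega, by omega⟩)
    (Finset.mem_Icc.2 ⟨by omega, by omega⟩) (invDist_one_ne_two (by omega) hx)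
  have hA : 0 ≤ ∑ k ∈ Finset.Icc 1 n, invDist n x k :=
    Finset.sum_nonneg fun k hk => (invDist_pos hx hk).le
  have hcoef : 1 - x ^ 5 ≤ (1 - x ^ 2) * (1 + x ^ 5) * Q := by
    have : (1 - x ^ 2) * (1 + x ^ 5) * Q = (1 + x ^ 5) * (1 - x ^ n) / (1 + x ^ n) := by
      rw [hQ]
      field_simp
    rw [this, le_div_iff₀ (by positivity)]
    nlinarith
  calc _ ≤ (1 - x ^ 2) * (1 + x ^ 5) * Q * ∑ k ∈ Finset.Icc 1 n, invDist n x k := by gcongr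
    _ = (1 - x ^ 2) * (1 + x ^ 5) * (Q * ∑ k ∈ Finset.Icc 1 n, invDist n x k) := by ring
    _ < _ := by gcongr

lemma poly_bound_four {x : ℝ} (hx : 1 / 2 < x) (hx1 : x < 1) :
    (1 - x ^ 5) * (1 + x ^ 4) <
      (1 - x ^ 2) * (1 + x ^ 5) * (2 * (1 + x ^ 2) - (74 / 25 + x ^ 4) / (14 / 5)) := by
  have key : ∀ i j : ℕ, 0 ≤ (x - 1 / 2) ^ i * (1 - x) ^ j := fun i j => by
    have h1 := sub_pos.2 hx
    have h2 := sub_pos.2 hx1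
    positivity
  have hP : 0 < (1 + x) * (1 + x ^ 5) * (2 * (1 + x ^ 2) - (74 / 25 + x ^ 4) / (14 / 5)) -
      (1 + x + x ^ 2 + x ^ 3 + x ^ 4) * (1 + x ^ 4) := by
    linarith [key 0 10, key 1 9, key 2 8, key 3 7, key 4 6, key 5 5, key 6 4, key 7 3, key 8 2,
      key 9 1, key 10 0]
  nlinarith [mul_pos (sub_pos.2 hx1) hP]

lemma invDist_eq_of_cos_eq {n k l : ℕ} (h : Real.cos (phi n k) = Real.cos (phi n l)) (x : ℝ) :
    invDist n x k = invDist n x l := by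
  rw [invDist, invDist, sqDist, sqDist, h]

lemma invDist_sum_lt_four {x : ℝ} (hx : 1 / 2 < x) (hx1 : x < 1) :
    (1 - x ^ 5) * ∑ k ∈ Finset.Icc 1 4, invDist 4 x k <
      (1 - x ^ 2) * (1 + x ^ 5) * ∑ k ∈ Finset.Icc 1 4, invDist 4 x k ^ 3 := by
  have hx0 : 0 < x := by linarith
  have c1 : Real.cos (phi 4 1) = √2 / 2 := by
    rw [← Real.cos_pi_div_four, phi]
    congr 1
    push_cast
    ring
  have c2 : Real.cos (phi 4 2) = -(√2 / 2) := by
    rw [← Real.cos_pi_div_four, ← Real.cos_pi_sub, phi]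
    congr 1
    push_cast
    ring
  have c3 : Real.cos (phi 4 3) = -(√2 / 2) := by
    rw [← Real.cos_pi_div_four, ← Real.cos_add_pi, phi]
    congr 1
    push_cast
    ring
  have c4 : Real.cos (phi 4 4) = √2 / 2 := by
    rw [← Real.cos_pi_div_four, ← Real.cos_two_pi_sub, phi]
    congr 1
    push_cast
    ring
  have e4 := invDist_eq_of_cos_eq (c4.trans c1.symm) x
  have e3 := invDist_eq_of_cos_eq (c3.trans c2.symm) x
  have m1 : 1 ∈ Finset.Icc 1 4 := by decide
  have m2 : 2 ∈ Finset.Icc 1 4 := by decide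
  have a0 := invDist_pos hx0 m1
  have b0 := invDist_pos hx0 m2
  have ha := invDist_sq_mul hx0 m1
  have hb := invDist_sq_mul hx0 m2
  rw [c1] at ha
  rw [c2] at hb
  simp only [Finset.sum_Icc_succ_top (by norm_num : 1 ≤ 3 + 1),
    Finset.sum_Icc_succ_top (by norm_num : 1 ≤ 2 + 1),
    Finset.sum_Icc_succ_top (by norm_num : 1 ≤ 1 + 1), Finset.Icc_self, Finset.sum_singleton,
    Nat.reduceAdd, e3, e4]
  set a := invDist 4 x 1
  set b := invDist 4 x 2
  have h2 : √2 ^ 2 = 2 := Real.sq_sqrt (by norm_num)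
  have hp : (a * b) ^ 2 * (1 + x ^ 4) = 1 := by
    have : (a ^ 2 * (1 + x ^ 2 - 2 * x * (√2 / 2))) * (b ^ 2 * (1 + x ^ 2 - 2 * x * -(√2 / 2))) =
        1 := by
      rw [ha, hb, mul_one]
    linear_combination this + a ^ 2 * b ^ 2 * x ^ 2 * h2
  have hs : a ^ 2 + b ^ 2 = 2 * (1 + x ^ 2) * (a * b) ^ 2 := by
    linear_combination (-b ^ 2) * ha + (-a ^ 2) * hb
  have hW : a * b ≤ (a * b) ^ 2 * ((74 / 25 + x ^ 4) / (14 / 5)) := by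
    nlinarith [sq_nonneg (7 / 5 * (a * b) - 1)]
  have hpos : 0 < a * b := mul_pos a0 b0
  have hc : 0 < (1 - x ^ 2) * (1 + x ^ 5) := by
    have : 0 < 1 - x ^ 2 := by nlinarith
    positivity
  have hmain : 1 - x ^ 5 < (1 - x ^ 2) * (1 + x ^ 5) * (a ^ 2 + b ^ 2 - a * b) := by
    calc 1 - x ^ 5 = (a * b) ^ 2 * ((1 - x ^ 5) * (1 + x ^ 4)) := by
          linear_combination (-(1 - x ^ 5)) * hp
      _ < (a * b) ^ 2 * ((1 - x ^ 2) * (1 + x ^ 5) *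
          (2 * (1 + x ^ 2) - (74 / 25 + x ^ 4) / (14 / 5))) := by
        exact mul_lt_mul_of_pos_left (poly_bound_four hx hx1) (by positivity)
      _ = (1 - x ^ 2) * (1 + x ^ 5) * (a ^ 2 + b ^ 2 -
          (a * b) ^ 2 * ((74 / 25 + x ^ 4) / (14 / 5))) := by
        rw [hs]
        ring
      _ ≤ _ := by gcongr
  linear_combination 2 * (a + b) * hmain

lemma invDist_sum_lt {n : ℕ} (hn : 4 ≤ n) {x : ℝ} (hx : 1 / 2 < x) (hx1 : x < 1) :
    (1 - x ^ 5) * ∑ k ∈ Finset.Icc 1 n, invDist n x k <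
      (1 - x ^ 2) * (1 + x ^ 5) * ∑ k ∈ Finset.Icc 1 n, invDist n x k ^ 3 := by
  rcases hn.eq_or_lt with rfl | h
  · exact invDist_sum_lt_four hx hx1
  · exact invDist_sum_lt_of_five_le h (by linarith) hx1

lemma mul_kn {n : ℕ} (hn : n ≠ 0) :
    n * kn n = 1 / 4 * ∑ k ∈ Finset.Icc 1 (n - 1), 1 / Real.sin (k * Real.pi / n) := by
  have : (n : ℝ) ≠ 0 := by exact_mod_cast hn
  rw [kn, ← mul_assoc]
  congr 1
  field_simp

lemma mul_pi_div_mem {n k : ℕ} (hk : k ∈ Finset.Icc 1 (n - 1)) :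
    k * Real.pi / n ∈ Set.Ioo 0 Real.pi := by
  rw [Finset.mem_Icc] at hk
  have h1 : (1 : ℝ) ≤ k := by exact_mod_cast hk.1
  have h2 : (k : ℝ) < n := by exact_mod_cast (by omega : k < n)
  have hpi := Real.pi_pos
  refine ⟨by have : (0 : ℝ) < n := by linarith
             positivity, ?_⟩
  rw [div_lt_iff₀ (by linarith)]
  nlinarith

lemma sum_sin_sq {n : ℕ} (hn : 2 ≤ n) :
    ∑ k ∈ Finset.Icc 1 (n - 1), Real.sin (k * Real.pi / n) ^ 2 = n / 2 := by
  obtain ⟨m, rfl⟩ : ∃ m, n = m + 1 := ⟨n - 1, by omega⟩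
  set N := m + 1 with hN
  have hp := Complex.isPrimitiveRoot_exp N (by omega)
  have h0 := congrArg Complex.re (sum_Icc_pow_eq_zero hp.pow_eq_one (hp.ne_one (by omega)))
  have hre : ∀ k : ℕ, (Complex.exp (2 * Real.pi * Complex.I / N) ^ k).re =
      1 - 2 * Real.sin (k * Real.pi / N) ^ 2 := by
    intro k
    rw [← Complex.exp_nat_mul, show (k : ℂ) * (2 * Real.pi * Complex.I / N) =
      ((2 * (k * Real.pi / N) : ℝ) : ℂ) * Complex.I by push_cast; ring,
      Complex.exp_ofReal_mul_I_re, Real.cos_two_mul]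
    linarith [Real.sin_sq_add_cos_sq (k * Real.pi / N)]
  have hpi : Real.sin (N * Real.pi / N) = 0 := by
    rw [mul_div_cancel_left₀ _ (by positivity : (N : ℝ) ≠ 0), Real.sin_pi]
  have htop : ∑ k ∈ Finset.Icc 1 N, Real.sin (k * Real.pi / N) ^ 2 =
      ∑ k ∈ Finset.Icc 1 m, Real.sin (k * Real.pi / N) ^ 2 := by
    rw [hN, Finset.sum_Icc_succ_top (by omega), ← hN, hpi]
    ring
  rw [Complex.re_sum, Finset.sum_congr rfl fun k _ => hre k, Finset.sum_sub_distrib,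
    ← Finset.mul_sum, htop] at h0
  simp at h0
  rw [Nat.add_sub_cancel]
  linarith

lemma le_mul_kn_of_five_le {n : ℕ} (hn : 5 ≤ n) : 19 / 80 * (n : ℝ) ≤ n * kn n := by
  have hnr : (5 : ℝ) ≤ n := by exact_mod_cast hn
  have hterm : ∀ k ∈ Finset.Icc 1 (n - 1),
      3 / 2 - 1 / 2 * Real.sin (k * Real.pi / n) ^ 2 ≤ 1 / Real.sin (k * Real.pi / n) := by
    intro k hk
    have hs := Real.sin_pos_of_mem_Ioo (mul_pi_div_mem hk)
    rw [le_div_iff₀ hs]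
    nlinarith [mul_nonneg (sq_nonneg (Real.sin (k * Real.pi / n) - 1))
      (by linarith : 0 ≤ Real.sin (k * Real.pi / n) + 2)]
  have h := Finset.sum_le_sum hterm
  rw [Finset.sum_sub_distrib, ← Finset.mul_sum, sum_sin_sq (by omega)] at h
  simp at h
  rw [Nat.cast_sub (by omega)] at h
  rw [mul_kn (by omega)]
  simp only [one_div] at h ⊢
  push_cast at h
  linarith

lemma le_mul_kn_four : 19 / 80 * (4 : ℝ) ≤ (4 : ℕ) * kn 4 := by
  have s1 : Real.sin ((1 : ℕ) * Real.pi / (4 : ℕ)) = √2 / 2 := by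
    rw [← Real.sin_pi_div_four]
    congr 1
    push_cast
    ring
  have s2 : Real.sin ((2 : ℕ) * Real.pi / (4 : ℕ)) = 1 := by
    rw [← Real.sin_pi_div_two]
    congr 1
    push_cast
    ring
  have s3 : Real.sin ((3 : ℕ) * Real.pi / (4 : ℕ)) = √2 / 2 := by
    rw [← Real.sin_pi_div_four, ← Real.sin_pi_sub]
    congr 1
    push_cast
    ring
  have h2 : √2 ^ 2 = 2 := Real.sq_sqrt (by norm_num)
  have hpos : 0 < √2 := by positivity
  have hinv : 1 / (√2 / 2) = √2 := by
    field_simp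
    linarith
  have hlow : (1.41 : ℝ) ≤ √2 := Real.le_sqrt_of_sq_le (by norm_num)
  rw [mul_kn (by norm_num)]
  simp only [Nat.add_one_sub_one,
    Finset.sum_Icc_succ_top (by norm_num : 1 ≤ 2 + 1),
    Finset.sum_Icc_succ_top (by norm_num : 1 ≤ 1 + 1), Finset.Icc_self, Finset.sum_singleton,
    Nat.reduceAdd, s1, s2, s3, hinv]
  linarith

lemma le_mul_kn {n : ℕ} (hn : 4 ≤ n) : 19 / 80 * (n : ℝ) ≤ n * kn n := by
  rcases hn.eq_or_lt with rfl | h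
  · exact_mod_cast le_mul_kn_four
  · exact le_mul_kn_of_five_le h

lemma radial_sum_lt_mul_kn {n : ℕ} (hn : 4 ≤ n) :
    (27 / 50 : ℝ) ^ 3 * ∑ k ∈ Finset.Icc 1 n, (1 - 27 / 50 * Real.cos (phi n k)) /
      (1 + (27 / 50) ^ 2 - 2 * (27 / 50) * Real.cos (phi n k)) ^ ((3 : ℝ) / 2) < n * kn n := by
  have hn0 : (0 : ℝ) < n := by exact_mod_cast (by omega : 0 < n)
  have hx : (0 : ℝ) < 27 / 50 := by norm_num
  have hterm : ∀ k ∈ Finset.Icc 1 n, (1 - 27 / 50 * Real.cos (phi n k)) /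
      (1 + (27 / 50) ^ 2 - 2 * (27 / 50) * Real.cos (phi n k)) ^ ((3 : ℝ) / 2) ≤
      10329 / 10000 * invDist n (27 / 50) k ^ 2 + 1 / 2 * (1 / 1.68 - 1 / 2) := by
    intro k hk
    rw [radial_term hx hk]
    have hs := invDist_pos hx hk
    have he := invDist_sq_mul hx hk
    set s := invDist n (27 / 50) k
    have hsp : 0 < s ^ 2 := by positivity
    have hlo : 50 / 77 ≤ s := by
      refine (sq_le_sq₀ (by norm_num) hs.le).1 ?_
      nlinarith [Real.neg_one_le_cos (phi n k)]
    have hhi : s ≤ 50 / 23 := by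
      refine (sq_le_sq₀ hs.le (by norm_num)).1 ?_
      nlinarith [Real.cos_le_one (phi n k)]
    have hcub : 0 ≤ (77 / 50 * s - 1) * (1 - 23 / 50 * s) * (s + 1 / 2) := by
      have h1 : 0 ≤ 77 / 50 * s - 1 := by linarith
      have h2 : 0 ≤ 1 - 23 / 50 * s := by linarith
      positivity
    nlinarith [sq_nonneg (0.84 * s - 1)]
  have hsum := sum_invDist_sq (by omega : n ≠ 0) hx
  have hfrac : (1 - (27 / 50 : ℝ) ^ n) / (1 + (27 / 50) ^ n) ≤ 1 := by
    have : (0 : ℝ) < (27 / 50) ^ n := by positivity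
    rw [div_le_one (by linarith)]
    linarith
  have hQ : ∑ k ∈ Finset.Icc 1 n, invDist n (27 / 50) k ^ 2 ≤ n / 0.7084 := by
    rw [le_div_iff₀ (by norm_num)]
    have := mul_le_mul_of_nonneg_left hfrac hn0.le
    linarith
  have h := Finset.sum_le_sum hterm
  rw [Finset.sum_add_distrib, ← Finset.mul_sum] at h
  simp only [Finset.sum_const, Nat.card_Icc, Nat.add_sub_cancel, nsmul_eq_mul] at h
  refine (mul_le_mul_of_nonneg_left h (by norm_num)).trans_lt (lt_of_lt_of_le ?_ (le_mul_kn hn))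
  norm_num at hQ ⊢
  linarith

lemma two_div_sin_le {y h : ℝ} (h1 : 0 < Real.sin (y - h)) (h2 : 0 < Real.sin (y + h))
    (hy : 0 < Real.sin y) :
    2 * (1 / Real.sin y) ≤ 1 / Real.sin (y - h) + 1 / Real.sin (y + h) := by
  have hab : Real.sin (y - h) + Real.sin (y + h) ≤ 2 * Real.sin y := by
    rw [Real.sin_sub, Real.sin_add]
    nlinarith [Real.cos_le_one h]
  rw [mul_one_div, div_add_div _ _ h1.ne' h2.ne', div_le_div_iff₀ hy (mul_pos h1 h2)]
  nlinarith [sq_nonneg (Real.sin (y - h) - Real.sin (y + h)), add_pos h1 h2]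

lemma sum_Icc_shift (f : ℕ → ℝ) (m : ℕ) :
    ∑ k ∈ Finset.Icc 1 m, f (k + 1) + f 1 = ∑ k ∈ Finset.Icc 1 (m + 1), f k := by
  induction m with
  | zero => simp
  | succ m ih =>
    rw [Finset.sum_Icc_succ_top (by omega), Finset.sum_Icc_succ_top (by omega), ← ih]
    ring

lemma sum_inv_sin_lt {n : ℕ} (hn : 1 ≤ n) :
    ∑ k ∈ Finset.Icc 1 (n - 1), 1 / Real.sin (k * Real.pi / n) <
      ∑ k ∈ Finset.Icc 1 n, 1 / Real.sin (phi n k / 2) := by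
  obtain ⟨m, rfl⟩ : ∃ m, n = m + 1 := ⟨n - 1, by omega⟩
  rw [Nat.add_sub_cancel]
  set f : ℕ → ℝ := fun k => 1 / Real.sin (phi (m + 1) k / 2) with hf
  have hpos : ∀ k ∈ Finset.Icc 1 (m + 1), 0 < Real.sin (phi (m + 1) k / 2) := fun k hk =>
    Real.sin_pos_of_mem_Ioo (half_phi_mem hk)
  have hterm : ∀ k ∈ Finset.Icc 1 m, 2 * (1 / Real.sin (k * Real.pi / (m + 1 : ℕ))) ≤
      f k + f (k + 1) := by
    intro k hk
    have hk' := Finset.mem_Icc.1 hk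
    have h1 := hpos k (Finset.mem_Icc.2 ⟨hk'.1, by omega⟩)
    have h2 := hpos (k + 1) (Finset.mem_Icc.2 ⟨by omega, by omega⟩)
    have h3 := Real.sin_pos_of_mem_Ioo (mul_pi_div_mem (n := m + 1) (k := k) (by simpa using hk))
    have e1 : phi (m + 1) k / 2 =
        k * Real.pi / (m + 1 : ℕ) - Real.pi / (2 * (m + 1 : ℕ)) := by
      unfold phi
      field_simp
    have e2 : phi (m + 1) (k + 1) / 2 =
        k * Real.pi / (m + 1 : ℕ) + Real.pi / (2 * (m + 1 : ℕ)) := by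
      unfold phi
      push_cast
      field_simp
      ring
    simp only [hf]
    rw [e1] at h1 ⊢
    rw [e2] at h2 ⊢
    exact two_div_sin_le h1 h2 h3
  have h := Finset.sum_le_sum hterm
  rw [← Finset.mul_sum, Finset.sum_add_distrib] at h
  have hs := sum_Icc_shift f m
  have ht := Finset.sum_Icc_succ_top (by omega : 1 ≤ m + 1) f
  have p1 : 0 < f 1 := one_div_pos.2 (hpos 1 (Finset.mem_Icc.2 ⟨le_rfl, by omega⟩))
  have p2 : 0 < f (m + 1) := one_div_pos.2 (hpos (m + 1) (Finset.mem_Icc.2 ⟨by omega, le_rfl⟩))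
  linarith

lemma invDist_one {n k : ℕ} (hk : k ∈ Finset.Icc 1 n) :
    invDist n 1 k = 1 / 2 * (1 / Real.sin (phi n k / 2)) := by
  have hs := Real.sin_pos_of_mem_Ioo (half_phi_mem hk)
  have : sqDist n 1 k = (2 * Real.sin (phi n k / 2)) ^ 2 := by
    unfold sqDist
    linear_combination 2 * one_sub_cos_phi n k
  rw [invDist, this, Real.sqrt_sq (by positivity)]
  field_simp

lemma mul_kn_lt_radial_sum_one {n : ℕ} (hn : 1 ≤ n) :
    n * kn n < (1 : ℝ) ^ 3 * ∑ k ∈ Finset.Icc 1 n, (1 - 1 * Real.cos (phi n k)) /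
      (1 + 1 ^ 2 - 2 * 1 * Real.cos (phi n k)) ^ ((3 : ℝ) / 2) := by
  rw [sum_radial n one_pos, Finset.sum_congr rfl fun k hk => invDist_one (n := n) hk,
    ← Finset.mul_sum, mul_kn (by omega)]
  linarith [sum_inv_sin_lt hn]

lemma continuousOn_radial_sum (n : ℕ) :
    ContinuousOn (fun x : ℝ => x ^ 3 * ∑ k ∈ Finset.Icc 1 n, (1 - x * Real.cos (phi n k)) /
      (1 + x ^ 2 - 2 * x * Real.cos (phi n k)) ^ ((3 : ℝ) / 2)) (Set.Icc (27 / 50) 1) := by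
  refine (continuousOn_id.pow 3).mul (continuousOn_finsetSum _ fun k hk => ?_)
  have hpos : ∀ x ∈ Set.Icc (27 / 50 : ℝ) 1, 0 < 1 + x ^ 2 - 2 * x * Real.cos (phi n k) :=
    fun x hx => sqDist_pos (by linarith [hx.1]) hk
  refine ContinuousOn.div (by fun_prop) (ContinuousOn.rpow_const (by fun_prop) fun x hx =>
    Or.inl (hpos x hx).ne') fun x hx => (Real.rpow_pos_of_pos (hpos x hx) _).ne'

/-- For every `n ≥ 4` there exists `x_n* ∈ (54/100, 1)` with `h₁(x_n*) = 0` and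
`h₀(x_n*) > 0`. -/
theorem exists_xstar (n : ℕ) (hn : 4 ≤ n) :
    ∃ x : ℝ, x ∈ Set.Ioo (54 / 100 : ℝ) 1 ∧ h1 n x = 0 ∧ 0 < h0 n x := by
  obtain ⟨x, ⟨hlo, hx1⟩, hroot⟩ := intermediate_value_Ioo (by norm_num : (27 / 50 : ℝ) ≤ 1)
    (continuousOn_radial_sum n) ⟨radial_sum_lt_mul_kn hn, mul_kn_lt_radial_sum_one (by omega)⟩
  have hx0 : 0 < x := by linarith
  have hx3 : 0 < 1 - x ^ 3 := sub_pos.2 (pow_lt_one₀ hx0.le hx1 (by norm_num))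
  refine ⟨x, ⟨by linarith, hx1⟩, ?_, ?_⟩
  · simp only at hroot
    rw [h1, ← hroot]
    ring
  · simp only [sum_radial n hx0] at hroot
    have hlt := invDist_sum_lt hn (by linarith : 1 / 2 < x) hx1
    rw [h0, ← hroot, sum_cos n hx0]
    set A := ∑ k ∈ Finset.Icc 1 n, invDist n x k
    set B := ∑ k ∈ Finset.Icc 1 n, invDist n x k ^ 3
    have : -(x ^ 3 * (((1 - x ^ 2) * B + A) / 2)) +
        x ^ 2 * (1 - x ^ 2) / (1 - x ^ 3) * (((1 + x ^ 2) * B - A) / (2 * x)) =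
        x / (2 * (1 - x ^ 3)) * ((1 - x ^ 2) * (1 + x ^ 5) * B - (1 - x ^ 5) * A) := by
      field_simp
      ring
    rw [this]
    have := sub_pos.2 hlt
    positivity
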